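/- Let Ω = {v ∈ ℝ² : W(v) ≠ 0} and f = log(Re W) on Ω, and let λ > 1. Then: (i) for every v ∈ Ω and u ∈ ℝ², −((λ−1)/3)·Hess f(v)(u,u) ≥ (3(λ−1)/4)·|u|² + ((λ−1)/18)·⟨∇f(v), u⟩², i.e. the deltoid operator ℒ^{(λ)} = Δ + ((λ−1)/3)∇f·∇ satisfies CD(3(λ−1)/4, 2λ); and (ii) this curvature constant is optimal: for every ρ > 3(λ−1)/4 there exist v ∈ Ω and u ∈ ℝ² with −((λ−1)/3)·Hess f(v)(u,u) < ρ·|u|² + ((λ−1)/18)·⟨∇f(v), u⟩². -/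

import Mathlib

open scoped RealInnerProductSpace
noncomputable section

/-- The plane `ℝ²`. -/
abbrev Plane := EuclideanSpace ℝ (Fin 2)

/-- The three unit vectors `E₁ = (1,0)`, `E₂ = (−1/2, √3/2)`, `E₃ = (−1/2, −√3/2)`. -/
def E : Fin 3 → Plane := fun k =>
  (WithLp.equiv 2 (Fin 2 → ℝ)).symm
    (![![1, 0], ![-(1/2), Real.sqrt 3 / 2], ![-(1/2), -(Real.sqrt 3 / 2)]] k)

/-- `z_k(v) = exp(i⟨v, E_k⟩)`. -/
def z (k : Fin 3) (v : Plane) : ℂ := Complex.exp (Complex.I * ((⟪v, E k⟫ : ℝ) : ℂ))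

/-- `W = −((z₁−z₂)(z₂−z₃)(z₃−z₁))²`. -/
def W (v : Plane) : ℂ :=
  -((z 0 v - z 1 v) * (z 1 v - z 2 v) * (z 2 v - z 0 v)) ^ 2

/-- The open set `Ω = {W ≠ 0}`. -/
def Omega : Set Plane := {v | W v ≠ 0}

/-- `f = log (Re W)`. -/
def fdel (v : Plane) : ℝ := Real.log (W v).re

/-- The Hessian (second Fréchet derivative) of a scalar function, as a bilinear form. -/
def Hess (g : Plane → ℝ) (v u w : Plane) : ℝ := fderiv ℝ (fderiv ℝ g) v u w

open Complex in
/-- The half-angle factorization of a difference of two points of the unit circle. -/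
lemma exp_mul_I_sub_exp_mul_I (a b : ℂ) :
    exp (I * a) - exp (I * b) = 2 * I * exp (I * ((a + b) / 2)) * sin ((a - b) / 2) := by
  have ha : exp (I * a) = exp (I * ((a + b) / 2)) * exp ((a - b) / 2 * I) := by
    rw [← exp_add]; ring_nf
  have hb : exp (I * b) = exp (I * ((a + b) / 2)) * exp (-((a - b) / 2) * I) := by
    rw [← exp_add]; ring_nf
  rw [ha, hb, sin]
  linear_combination (exp (I * ((a + b) / 2)) * (exp (-((a - b) / 2) * I) -
    exp ((a - b) / 2 * I))) * (-I_mul_I)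

/-- The half root `(E_j - E_{j+1}) / 2`. -/
def halfRoot (j : Fin 3) : Plane := (1 / 2 : ℝ) • (E j - E (j + 1))

lemma sum_E : E 0 + E 1 + E 2 = 0 := by
  ext i
  fin_cases i
  · simp [E]
    norm_num
  · simp [E]

lemma W_eq (v : Plane) :
    W v = ((64 * (∏ j, Real.sin ⟪halfRoot j, v⟫) ^ 2 : ℝ) : ℂ) := by
  have hs : ⟪v, E 0⟫ + ⟪v, E 1⟫ + ⟪v, E 2⟫ = 0 := by
    rw [← inner_add_right, ← inner_add_right, sum_E, inner_zero_right]
  have hx (j : Fin 3) : ⟪halfRoot j, v⟫ = (⟪v, E j⟫ - ⟪v, E (j + 1)⟫) / 2 := by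
    rw [real_inner_comm, halfRoot, real_inner_smul_right, inner_sub_right]
    ring
  simp only [hx, Fin.prod_univ_three, W, z, exp_mul_I_sub_exp_mul_I]
  simp only [show (0 : Fin 3) + 1 = 1 from rfl, show (1 : Fin 3) + 1 = 2 from rfl,
    show (2 : Fin 3) + 1 = 0 from rfl]
  generalize ⟪v, E 0⟫ = a, ⟪v, E 1⟫ = b, ⟪v, E 2⟫ = c at *
  have he : Complex.exp (Complex.I * ((a + b) / 2)) * Complex.exp (Complex.I * ((b + c) / 2)) *
      Complex.exp (Complex.I * ((c + a) / 2)) = 1 := by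
    rw [← Complex.exp_add, ← Complex.exp_add, ← Complex.exp_zero]
    congr 1
    have : (a : ℂ) + b + c = 0 := by exact_mod_cast hs
    linear_combination Complex.I * this
  push_cast
  generalize Complex.exp (Complex.I * ((a + b) / 2)) = p,
    Complex.exp (Complex.I * ((b + c) / 2)) = q, Complex.exp (Complex.I * ((c + a) / 2)) = r at *
  generalize Complex.sin ((a - b) / 2) = s, Complex.sin ((b - c) / 2) = t,
    Complex.sin ((c - a) / 2) = u
  calc _ = -64 * (Complex.I ^ 2) ^ 3 * (p * q * r) ^ 2 * (s * t * u) ^ 2 := by ring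
    _ = _ := by rw [he, Complex.I_sq]; ring

lemma mem_Omega_iff (v : Plane) : v ∈ Omega ↔ ∀ j, Real.sin ⟪halfRoot j, v⟫ ≠ 0 := by
  simp [Omega, W_eq, Finset.prod_eq_zero_iff, -Complex.ofReal_sin]

lemma isOpen_Omega : IsOpen Omega := by
  have : Omega = ⋂ j, {v : Plane | Real.sin ⟪halfRoot j, v⟫ ≠ 0} := by
    ext v
    simp [mem_Omega_iff]
  rw [this]
  exact isOpen_iInter_of_finite fun j => isOpen_ne_fun (by fun_prop) continuous_const

lemma fdel_eq {v : Plane} (hv : v ∈ Omega) :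
    fdel v = Real.log 64 + 2 * ∑ j, Real.log (Real.sin ⟪halfRoot j, v⟫) := by
  rw [mem_Omega_iff] at hv
  rw [fdel, W_eq, Complex.ofReal_re, Real.log_mul (by norm_num)
    (pow_ne_zero _ (Finset.prod_ne_zero_iff.2 fun j _ => hv j)), Real.log_pow,
    Real.log_prod fun j _ => hv j]
  norm_num

lemma hasFDerivAt_fdel {v : Plane} (hv : v ∈ Omega) :
    HasFDerivAt fdel ((2 : ℝ) • ∑ j, Real.cot ⟪halfRoot j, v⟫ • innerSL ℝ (halfRoot j)) v := by
  have h (j : Fin 3) : HasFDerivAt (fun w : Plane => Real.log (Real.sin ⟪halfRoot j, w⟫))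
      (Real.cot ⟪halfRoot j, v⟫ • innerSL ℝ (halfRoot j)) v := by
    have h1 : HasDerivAt (fun x => Real.log (Real.sin x)) (Real.cot ⟪halfRoot j, v⟫)
        (innerSL ℝ (halfRoot j) v) := by
      rw [Real.cot_eq_cos_div_sin]
      exact (Real.hasDerivAt_sin _).log ((mem_Omega_iff v).1 hv j)
    exact h1.comp_hasFDerivAt v (innerSL ℝ (halfRoot j)).hasFDerivAt
  have hsum := ((HasFDerivAt.fun_sum fun j (_ : j ∈ Finset.univ) => h j).const_mul
    (2 : ℝ)).const_add (Real.log 64)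
  refine hsum.congr_of_eventuallyEq ?_
  filter_upwards [isOpen_Omega.mem_nhds hv] with w hw using fdel_eq hw

lemma hasDerivAt_cot {x : ℝ} (hx : Real.sin x ≠ 0) :
    HasDerivAt Real.cot (-(1 + Real.cot x ^ 2)) x := by
  have h := (Real.hasDerivAt_cos x).div (Real.hasDerivAt_sin x) hx
  rw [show Real.cos / Real.sin = Real.cot from (funext Real.cot_eq_cos_div_sin).symm] at h
  refine h.congr_deriv ?_
  rw [Real.cot_eq_cos_div_sin]
  field_simp
  ring

lemma inner_gradient_fdel {v : Plane} (hv : v ∈ Omega) (u : Plane) :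
    ⟪gradient fdel v, u⟫ = 2 * ∑ j, Real.cot ⟪halfRoot j, v⟫ * ⟪halfRoot j, u⟫ := by
  rw [gradient, InnerProductSpace.toDual_symm_apply, (hasFDerivAt_fdel hv).fderiv]
  simp

lemma Hess_fdel {v : Plane} (hv : v ∈ Omega) (u : Plane) :
    Hess fdel v u u =
      -2 * ∑ j, (1 + Real.cot ⟪halfRoot j, v⟫ ^ 2) * ⟪halfRoot j, u⟫ ^ 2 := by
  have h (j : Fin 3) : HasFDerivAt
      (fun w : Plane => Real.cot ⟪halfRoot j, w⟫ • innerSL ℝ (halfRoot j))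
      ((-(1 + Real.cot ⟪halfRoot j, v⟫ ^ 2) • innerSL ℝ (halfRoot j)).smulRight
        (innerSL ℝ (halfRoot j))) v := by
    have h1 : HasDerivAt Real.cot (-(1 + Real.cot ⟪halfRoot j, v⟫ ^ 2))
        (innerSL ℝ (halfRoot j) v) := hasDerivAt_cot ((mem_Omega_iff v).1 hv j)
    exact (h1.comp_hasFDerivAt v (innerSL ℝ (halfRoot j)).hasFDerivAt).smul_const
      (innerSL ℝ (halfRoot j))
  have hsum := (HasFDerivAt.fun_sum fun j (_ : j ∈ Finset.univ) => h j).const_smul (2 : ℝ)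
  have heq : fderiv ℝ fdel =ᶠ[nhds v] fun w =>
      (2 : ℝ) • ∑ j, Real.cot ⟪halfRoot j, w⟫ • innerSL ℝ (halfRoot j) := by
    filter_upwards [isOpen_Omega.mem_nhds hv] with w hw using (hasFDerivAt_fdel hw).fderiv
  rw [Hess, (hsum.congr_of_eventuallyEq heq).fderiv]
  simp only [Fin.sum_univ_three, smul_apply, add_apply,
    ContinuousLinearMap.smulRight_apply, innerSL_apply_apply,
    smul_eq_mul]
  ring

lemma inner_halfRoot (u : Plane) :
    ⟪halfRoot 0, u⟫ = 3 / 4 * u 0 - √3 / 4 * u 1 ∧ ⟪halfRoot 1, u⟫ = √3 / 2 * u 1 ∧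
      ⟪halfRoot 2, u⟫ = -(3 / 4) * u 0 - √3 / 4 * u 1 := by
  refine ⟨?_, ?_, ?_⟩ <;>
    · simp [halfRoot, E, PiLp.inner_apply, Fin.sum_univ_two]
      ring

lemma sum_inner_halfRoot_sq (u : Plane) : ∑ j, ⟪halfRoot j, u⟫ ^ 2 = 9 / 8 * ‖u‖ ^ 2 := by
  obtain ⟨h0, h1, h2⟩ := inner_halfRoot u
  rw [Fin.sum_univ_three, h0, h1, h2, EuclideanSpace.real_norm_sq_eq, Fin.sum_univ_two]
  linear_combination (3 / 8 * u 1 ^ 2) * Real.sq_sqrt (show (0 : ℝ) ≤ 3 by norm_num)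

/-- The deficit in the curvature-dimension inequality is a variance. -/
lemma CD_deficit_eq (lam : ℝ) {v : Plane} (hv : v ∈ Omega) (u : Plane) :
    -((lam - 1) / 3) * Hess fdel v u u = (3 * (lam - 1) / 4) * ‖u‖ ^ 2 +
      ((lam - 1) / 18) * ⟪gradient fdel v, u⟫ ^ 2 + 2 * (lam - 1) / 9 *
        (3 * ∑ j, (Real.cot ⟪halfRoot j, v⟫ * ⟪halfRoot j, u⟫) ^ 2 -
          (∑ j, Real.cot ⟪halfRoot j, v⟫ * ⟪halfRoot j, u⟫) ^ 2) := by
  have h := sum_inner_halfRoot_sq u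
  rw [Hess_fdel hv, inner_gradient_fdel hv]
  simp only [Fin.sum_univ_three] at h ⊢
  linear_combination 2 * (lam - 1) / 3 * h

/-- A direction whose inner products with the half roots are `1, 1, -2`. -/
def optimalDirection : Plane := !₂[2, 2 / √3]

lemma inner_halfRoot_optimalDirection :
    ⟪halfRoot 0, optimalDirection⟫ = 1 ∧ ⟪halfRoot 1, optimalDirection⟫ = 1 ∧
      ⟪halfRoot 2, optimalDirection⟫ = -2 := by
  obtain ⟨h0, h1, h2⟩ := inner_halfRoot optimalDirection
  have h3 : √3 ≠ 0 := by positivity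
  rw [h0, h1, h2]
  simp only [optimalDirection, PiLp.toLp_apply, Matrix.cons_val_zero, Matrix.cons_val_one]
  field_simp
  norm_num

lemma two_mul_cot_two_mul {s : ℝ} (hs : Real.sin s ≠ 0) (hc : Real.cos s ≠ 0) :
    2 * Real.cot (2 * s) = Real.cot s - Real.tan s := by
  rw [Real.cot_eq_cos_div_sin, Real.cot_eq_cos_div_sin, Real.tan_eq_sin_div_cos,
    Real.cos_two_mul', Real.sin_two_mul]
  field_simp

lemma cot_neg_real (x : ℝ) : Real.cot (-x) = -Real.cot x := by
  rw [Real.cot_eq_cos_div_sin, Real.cot_eq_cos_div_sin, Real.cos_neg, Real.sin_neg, div_neg]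

/-- On the ray through the optimal direction the deficit is governed by `tan² s`. -/
lemma CD_deficit_optimalDirection (lam : ℝ) {s : ℝ} (hs : Real.sin s ≠ 0)
    (hc : Real.cos s ≠ 0) :
    s • optimalDirection ∈ Omega ∧
      -((lam - 1) / 3) * Hess fdel (s • optimalDirection) optimalDirection optimalDirection =
        (3 * (lam - 1) / 4) * ‖optimalDirection‖ ^ 2 +
          ((lam - 1) / 18) * ⟪gradient fdel (s • optimalDirection), optimalDirection⟫ ^ 2 +
          4 * (lam - 1) / 9 * Real.tan s ^ 2 := by
  obtain ⟨h0, h1, h2⟩ := inner_halfRoot_optimalDirection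
  have hmem : s • optimalDirection ∈ Omega := by
    rw [mem_Omega_iff, Fin.forall_fin_succ, Fin.forall_fin_two]
    simp only [real_inner_smul_right, Fin.succ_zero_eq_one, Fin.succ_one_eq_two, h0, h1, h2]
    have h : Real.sin (s * -2) = -(2 * Real.sin s * Real.cos s) := by
      rw [← Real.sin_two_mul, ← Real.sin_neg]; ring_nf
    rw [h]
    simp [hs, hc]
  refine ⟨hmem, ?_⟩
  rw [CD_deficit_eq lam hmem]
  have h : Real.cot (s * -2) * -2 = Real.cot s - Real.tan s := by
    rw [← two_mul_cot_two_mul hs hc, show s * -2 = -(2 * s) by ring, cot_neg_real]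
    ring
  simp only [Fin.sum_univ_three, real_inner_smul_right, h0, h1, h2, mul_one, h]
  ring

/-- For `λ > 1` the deltoid operator `ℒ^{(λ)}` satisfies `CD(3(λ−1)/4, 2λ)`, and the
curvature constant `3(λ−1)/4` is optimal. -/
theorem deltoid_CD_optimal :
    ∀ lam : ℝ, 1 < lam →
      (∀ v ∈ Omega, ∀ u : Plane,
        -((lam - 1)/3) * Hess fdel v u u ≥
          (3 * (lam - 1)/4) * ‖u‖ ^ 2 + ((lam - 1)/18) * ⟪gradient fdel v, u⟫ ^ 2) ∧
      (∀ ρ : ℝ, 3 * (lam - 1)/4 < ρ →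
        ∃ v ∈ Omega, ∃ u : Plane,
          -((lam - 1)/3) * Hess fdel v u u <
            ρ * ‖u‖ ^ 2 + ((lam - 1)/18) * ⟪gradient fdel v, u⟫ ^ 2) := by
  intro lam hlam
  have hl : 0 < lam - 1 := sub_pos.2 hlam
  refine ⟨fun v hv u => ?_, fun ρ hρ => ?_⟩
  · rw [CD_deficit_eq lam hv]
    have hcs := sq_sum_le_card_mul_sum_sq (s := Finset.univ)
      (f := fun j : Fin 3 => Real.cot ⟪halfRoot j, v⟫ * ⟪halfRoot j, u⟫)
    norm_num at hcs
    have := mul_nonneg (show 0 ≤ 2 * (lam - 1) / 9 by positivity) (sub_nonneg.2 hcs)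
    linarith
  · have hnorm : 0 < ‖optimalDirection‖ ^ 2 := by
      have h : optimalDirection ≠ 0 := fun h => by
        simpa [h] using inner_halfRoot_optimalDirection.1
      positivity
    have hlim : Filter.Tendsto (fun s => 4 * (lam - 1) / 9 * Real.tan s ^ 2)
        (nhdsWithin 0 (Set.Ioi 0)) (nhds 0) := by
      have h : ContinuousAt (fun s => 4 * (lam - 1) / 9 * Real.tan s ^ 2) 0 :=
        ((Real.continuousAt_tan.2 (by simp)).pow 2).const_mul _
      simpa using h.tendsto.mono_left nhdsWithin_le_nhds
    have hsmall := hlim.eventually_lt_const (mul_pos (sub_pos.2 hρ) hnorm)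
    obtain ⟨s, hs, hs0, hs1⟩ := (hsmall.and (Ioo_mem_nhdsGT one_pos)).exists
    have hpi := Real.pi_gt_three
    obtain ⟨hmem, heq⟩ := CD_deficit_optimalDirection lam
      (Real.sin_pos_of_pos_of_lt_pi hs0 (by linarith)).ne'
      (Real.cos_pos_of_mem_Ioo ⟨by linarith, by linarith⟩).ne'
    refine ⟨s • optimalDirection, hmem, optimalDirection, ?_⟩
    rw [heq]
    linarith
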